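/- arXiv:1504.02587 — 2 statements merged into one kernel-verified Lean document; each statement's English description precedes it below -/
import Mathlib

section
/- Let 𝒯 be a stubborn set assignment satisfying D0, D1 and D2. If t ∈ 𝒯(s₀), t₁ ∉ 𝒯(s₀), …, tₙ ∉ 𝒯(s₀), s₀ →[t₁] s₁ →[t₂] ⋯ →[tₙ] sₙ, and s₀ →[t] s'₀ →[t₁] s'₁ →[t₂] ⋯ →[tₙ] s'ₙ, then for every i with 1 ≤ i ≤ n we have sᵢ →[t] s'ᵢ. -/
/-- `TPath step s σ s'` means `s →[σ] s'`: firing the sequence `σ` of transitions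
from `s` yields `s'`. -/
inductive TPath {S T : Type*} (step : S → T → S → Prop) : S → List T → S → Prop
  | nil (s : S) : TPath step s [] s
  | cons {s s' s'' : S} {t : T} {σ : List T} :
      step s t s' → TPath step s' σ s'' → TPath step s (t :: σ) s''

/-- Transition `t` is enabled at `s`. -/
def Enabled {S T : Type*} (step : S → T → S → Prop) (s : S) (t : T) : Prop :=
  ∃ s', step s t s'

/-- A state is terminal iff no transition is enabled at it. -/
def Terminal {S T : Type*} (step : S → T → S → Prop) (s : S) : Prop :=
  ∀ t, ¬ Enabled step s t

/-- `s'` is reachable from `s`. -/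
def Reachable {S T : Type*} (step : S → T → S → Prop) (s s' : S) : Prop :=
  ∃ σ, TPath step s σ s'

/-- An r-edge: a step `s →[t] s'` with `t ∈ 𝒯 s`. -/
def REdge {S T : Type*} (step : S → T → S → Prop) (𝒯 : S → Set T)
    (s : S) (t : T) (s' : S) : Prop :=
  step s t s' ∧ t ∈ 𝒯 s

/-- The transition relation is deterministic. -/
def Deterministic {S T : Type*} (step : S → T → S → Prop) : Prop :=
  ∀ s t s₁ s₂, step s t s₁ → step s t s₂ → s₁ = s₂

/-- D0: if `s₀` is not terminal then `𝒯 s₀` contains an enabled transition. -/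
def D0 {S T : Type*} (step : S → T → S → Prop) (𝒯 : S → Set T) : Prop :=
  ∀ s₀, ¬ Terminal step s₀ → ∃ t ∈ 𝒯 s₀, Enabled step s₀ t

/-- D1: if `t ∈ 𝒯 s₀`, `t₁,…,tₙ ∉ 𝒯 s₀` and `s₀ →[t₁⋯tₙ t] s'`
then `s₀ →[t t₁⋯tₙ] s'`. -/
def D1 {S T : Type*} (step : S → T → S → Prop) (𝒯 : S → Set T) : Prop :=
  ∀ s₀ t σ s', t ∈ 𝒯 s₀ → (∀ u ∈ σ, u ∉ 𝒯 s₀) →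
    TPath step s₀ (σ ++ [t]) s' → TPath step s₀ (t :: σ) s'

/-- D2: if `t ∈ 𝒯 s₀` is enabled at `s₀`, `t₁,…,tₙ ∉ 𝒯 s₀` and `s₀ →[t₁⋯tₙ] sₙ`
then `t` is enabled at `sₙ`. -/
def D2 {S T : Type*} (step : S → T → S → Prop) (𝒯 : S → Set T) : Prop :=
  ∀ s₀ t σ sₙ, t ∈ 𝒯 s₀ → Enabled step s₀ t → (∀ u ∈ σ, u ∉ 𝒯 s₀) →
    TPath step s₀ σ sₙ → Enabled step sₙ t

theorem TPath.append {S T : Type*} {step : S → T → S → Prop} {s s' s'' : S} {σ τ : List T}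
    (h : TPath step s σ s') (h' : TPath step s' τ s'') : TPath step s (σ ++ τ) s'' := by
  induction h with
  | nil => exact h'
  | cons hs _ ih => exact .cons hs (ih h')

theorem TPath.eq_of_deterministic {S T : Type*} {step : S → T → S → Prop}
    (hdet : Deterministic step) {s s₁ s₂ : S} {σ : List T}
    (h₁ : TPath step s σ s₁) (h₂ : TPath step s σ s₂) : s₁ = s₂ := by
  induction h₁ with
  | nil => cases h₂; rfl
  | cons hs _ ih =>
    cases h₂ with
    | cons hs' h₂ =>
      obtain rfl := hdet _ _ _ _ hs hs'
      exact ih h₂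

theorem TPath.of_chain {S T : Type*} {step : S → T → S → Prop} {ts : ℕ → T} {f : ℕ → S} (n : ℕ)
    (h : ∀ i < n, step (f i) (ts i) (f (i + 1))) :
    TPath step (f 0) ((List.range n).map ts) (f n) := by
  induction n with
  | zero => exact .nil _
  | succ n ih =>
    rw [List.range_succ, List.map_append]
    exact (ih fun i hi => h i (by omega)).append (.cons (h n (by omega)) (.nil _))

/-- Lemma 1: if `t ∈ 𝒯 s₀`, `t₁,…,tₙ ∉ 𝒯 s₀`,
`s₀ →[t₁] s₁ →[t₂] ⋯ →[tₙ] sₙ` and `s₀ →[t] s'₀ →[t₁] s'₁ →[t₂] ⋯ →[tₙ] s'ₙ`,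
then for `1 ≤ i ≤ n` we have `sᵢ →[t] s'ᵢ`.  Here `f i = sᵢ`, `f' i = s'ᵢ`
and `ts i = t_{i+1}`. -/
theorem stmt3 {S T : Type*} (step : S → T → S → Prop) (𝒯 : S → Set T)
    (hdet : Deterministic step) (h0 : D0 step 𝒯) (h1 : D1 step 𝒯) (h2 : D2 step 𝒯)
    (n : ℕ) (t : T) (ts : ℕ → T) (f f' : ℕ → S)
    (ht : t ∈ 𝒯 (f 0))
    (hts : ∀ i < n, ts i ∉ 𝒯 (f 0))
    (hchain : ∀ i < n, step (f i) (ts i) (f (i + 1)))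
    (hstep : step (f 0) t (f' 0))
    (hchain' : ∀ i < n, step (f' i) (ts i) (f' (i + 1))) :
    ∀ i, 1 ≤ i → i ≤ n → step (f i) t (f' i) := by
  intro i _ hi
  have hpath := TPath.of_chain i fun j hj => hchain j (by omega)
  have hpath' := TPath.of_chain i fun j hj => hchain' j (by omega)
  have hmem : ∀ u ∈ (List.range i).map ts, u ∉ 𝒯 (f 0) := by
    intro u hu
    obtain ⟨j, hj, rfl⟩ := List.mem_map.1 hu
    exact hts j ((List.mem_range.1 hj).trans_le hi)
  obtain ⟨s, hs⟩ := h2 _ _ _ _ ht ⟨_, hstep⟩ hmem hpath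
  have hswap := h1 _ _ _ _ ht hmem (hpath.append (.cons hs (.nil _)))
  rwa [hswap.eq_of_deterministic hdet (.cons hstep hpath')] at hs
end

section
/- Let 𝒯 be a stubborn set assignment satisfying D0, D1 and D2, assume the system is AG EF terminating, and let P be a set of states (the progress states). Then the following are equivalent: (i) there exists a reachable state from which no state in P is reachable; (ii) there exists a reachable terminal state that is not in P; (iii) there exists an r-state that is terminal and not in P. -/
namespace TPath

variable {S T : Type*} {step : S → T → S → Prop}

theorem append_s12 {s s' s'' : S} {σ τ : List T} (h : TPath step s σ s')
    (h' : TPath step s' τ s'') : TPath step s (σ ++ τ) s'' := by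
  induction h with
  | nil => exact h'
  | cons hs _ ih => exact .cons hs (ih h')

theorem exists_of_append {s s'' : S} {σ τ : List T} (h : TPath step s (σ ++ τ) s'') :
    ∃ s', TPath step s σ s' ∧ TPath step s' τ s'' := by
  induction σ generalizing s with
  | nil => exact ⟨s, .nil s, h⟩
  | cons t σ ih =>
    obtain _ | ⟨hs, h⟩ := h
    obtain ⟨s', h₁, h₂⟩ := ih h
    exact ⟨s', .cons hs h₁, h₂⟩

theorem mono {step' : S → T → S → Prop} (hle : ∀ s t s', step s t s' → step' s t s')
    {s s' : S} {σ : List T} (h : TPath step s σ s') : TPath step' s σ s' := by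
  induction h with
  | nil s => exact .nil s
  | cons hs _ ih => exact .cons (hle _ _ _ hs) ih

theorem eq_of_terminal {s s' : S} {σ : List T} (h : TPath step s σ s')
    (hs : Terminal step s) : s' = s := by
  cases h with
  | nil => rfl
  | cons h₁ _ => exact absurd ⟨_, h₁⟩ (hs _)

end TPath

theorem Reachable.trans {S T : Type*} {step : S → T → S → Prop} {s s' s'' : S}
    (h : Reachable step s s') (h' : Reachable step s' s'') : Reachable step s s'' :=
  let ⟨_, p⟩ := h
  let ⟨_, q⟩ := h'
  ⟨_, p.append_s12 q⟩

theorem List.exists_eq_append_cons_of_first_mem {T : Type*} (A : Set T) {σ : List T}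
    (h : ∃ t ∈ σ, t ∈ A) :
    ∃ α t β, σ = α ++ t :: β ∧ t ∈ A ∧ ∀ u ∈ α, u ∉ A := by
  induction σ with
  | nil => simp at h
  | cons a σ ih =>
    by_cases ha : a ∈ A
    · exact ⟨[], a, σ, rfl, ha, by simp⟩
    · obtain ⟨α, t, β, rfl, ht, hα⟩ := ih (by simpa [ha] using h)
      exact ⟨a :: α, t, β, rfl, ht, by simpa [ha] using hα⟩

/-- Under D0, D1 and D2, every terminal state at the end of a path is reached from the
start of that path by r-edges. -/
theorem TPath.reachable_rEdge_of_terminal {S T : Type*} {step : S → T → S → Prop}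
    {𝒯 : S → Set T} (h0 : D0 step 𝒯) (h1 : D1 step 𝒯) (h2 : D2 step 𝒯)
    {s s' : S} {σ : List T} (h : TPath step s σ s') (hs' : Terminal step s') :
    Reachable (REdge step 𝒯) s s' := by
  induction hn : σ.length generalizing s σ with
  | zero =>
    obtain rfl := List.length_eq_zero_iff.mp hn
    cases h
    exact ⟨[], .nil _⟩
  | succ n ih =>
    have hs : ¬ Terminal step s := fun hs => by
      cases h with
      | nil => simp at hn
      | cons h₁ _ => exact hs _ ⟨_, h₁⟩
    have hex : ∃ t ∈ σ, t ∈ 𝒯 s := by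
      by_contra! hσ
      obtain ⟨t, ht, hen⟩ := h0 s hs
      exact hs' t (h2 s t σ s' ht hen hσ h)
    obtain ⟨α, t, β, rfl, ht, hα⟩ := List.exists_eq_append_cons_of_first_mem (𝒯 s) hex
    rw [List.append_cons] at h
    obtain ⟨m, hm, hβ⟩ := h.exists_of_append
    obtain _ | ⟨hst, hα'⟩ := h1 s t α m ht hα hm
    obtain ⟨ρ, hρ⟩ := ih (hα'.append_s12 hβ) (by simp at hn ⊢; omega)
    exact ⟨t :: ρ, .cons ⟨hst, ht⟩ hρ⟩

/-- Theorem 4: assuming the model is AG EF terminating, the following are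
equivalent: (i) there is a reachable state from which no progress state is
reachable; (ii) there is a reachable terminal state not in `P`; (iii) there is
an r-state that is terminal and not in `P`. -/
theorem stmt12 {S T : Type*} (step : S → T → S → Prop) (𝒯 : S → Set T) (sHat : S)
    (hdet : Deterministic step) (h0 : D0 step 𝒯) (h1 : D1 step 𝒯) (h2 : D2 step 𝒯)
    (hAGEF : ∀ s, Reachable step sHat s →
      ∃ s_t, Terminal step s_t ∧ Reachable step s s_t)
    (P : Set S) :
    ((∃ s, Reachable step sHat s ∧ ∀ p ∈ P, ¬ Reachable step s p) ↔
      (∃ s, Reachable step sHat s ∧ Terminal step s ∧ s ∉ P)) ∧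
    ((∃ s, Reachable step sHat s ∧ Terminal step s ∧ s ∉ P) ↔
      (∃ s, Reachable (REdge step 𝒯) sHat s ∧ Terminal step s ∧ s ∉ P)) := by
  refine ⟨⟨?_, ?_⟩, ?_, ?_⟩
  · rintro ⟨s, hs, hP⟩
    obtain ⟨s', hs', hr⟩ := hAGEF s hs
    exact ⟨s', hs.trans hr, hs', fun h => hP s' h hr⟩
  · rintro ⟨s, hs, ht, hP⟩
    refine ⟨s, hs, fun p hp ⟨_, h⟩ => hP ?_⟩
    rwa [← h.eq_of_terminal ht]
  · rintro ⟨s, ⟨_, h⟩, ht, hP⟩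
    exact ⟨s, h.reachable_rEdge_of_terminal h0 h1 h2 ht, ht, hP⟩
  · rintro ⟨s, ⟨σ, h⟩, ht, hP⟩
    exact ⟨s, ⟨σ, h.mono fun _ _ _ h => h.1⟩, ht, hP⟩
end
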